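/- arXiv:1106.4854 — 3 statements merged into one kernel-verified Lean document; each statement's English description precedes it below -/
import Mathlib

section
/- Let k ≥ 0 be an integer. A polynomial f ∈ ℤ[X] is divisible by S_{k+1} in ℤ[X] if and only if f(2cos(π(l+1)/(k+2))) = 0 for all l ∈ {0, 1, ..., k}. (This expresses that the ideal I_k(SU(2)) of the fusion ring, generated by the character χ_{k+1}, coincides with the ideal of characters vanishing at the special points t_l = j(e^{iπ(l+1)/(k+2)}).) -/
open Polynomial

/-- The polynomials `S_n ∈ ℤ[X]` with `S_0 = 1`, `S_1 = X`, `S_{n+1} = X·S_n − S_{n−1}`;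
under `R(SU(2)) ≅ ℤ[X]`, the character `χ_n` corresponds to `S_n`. -/
noncomputable def chebS : ℕ → Polynomial ℤ
  | 0 => 1
  | 1 => Polynomial.X
  | (n + 2) => Polynomial.X * chebS (n + 1) - chebS n

theorem chebS_monic_deg (n : ℕ) :
    ((chebS n).Monic ∧ (chebS n).natDegree = n) ∧
      ((chebS (n + 1)).Monic ∧ (chebS (n + 1)).natDegree = n + 1) := by
  induction n with
  | zero => exact ⟨by simp [chebS], by simp [chebS, monic_X]⟩
  | succ n ih =>
    obtain ⟨⟨h1, h2⟩, h3, h4⟩ := ih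
    refine ⟨⟨h3, h4⟩, ?_⟩
    have hm : (X * chebS (n + 1)).Monic := monic_X.mul h3
    have hd : (X * chebS (n + 1)).natDegree = n + 2 := by
      rw [monic_X.natDegree_mul h3, h4, natDegree_X]; ring
    have hlt : (chebS n).natDegree < (X * chebS (n + 1)).natDegree := by omega
    have e : chebS (n + 1 + 1) = X * chebS (n + 1) - chebS n := by rw [chebS]
    rw [e]
    exact ⟨hm.sub_of_left (degree_lt_degree hlt), by
      rw [natDegree_sub_eq_left_of_natDegree_lt hlt, hd]⟩

theorem chebS_cos (t : ℝ) (n : ℕ) :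
    aeval (2 * Real.cos t) (chebS n) * Real.sin t = Real.sin ((n + 1) * t) ∧
    aeval (2 * Real.cos t) (chebS (n + 1)) * Real.sin t = Real.sin ((n + 2) * t) := by
  induction n with
  | zero => simp [chebS, Real.sin_two_mul]; ring
  | succ n ih =>
    obtain ⟨h1, h2⟩ := ih
    refine ⟨by rw [h2]; push_cast; ring_nf, ?_⟩
    have e : chebS (n + 1 + 1) = X * chebS (n + 1) - chebS n := by rw [chebS]
    rw [e, map_sub, map_mul, aeval_X, sub_mul, mul_assoc, h2, h1]
    have a : ((n : ℝ) + 1) * t = (n + 2) * t - t := by ring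
    have b : (((n + 1 : ℕ) : ℝ) + 2) * t = (n + 2) * t + t := by push_cast; ring
    rw [a, b, Real.sin_sub, Real.sin_add]
    ring

theorem angle_mem (k l : ℕ) (h : l ≤ k) :
    0 < Real.pi * (l + 1) / (k + 2) ∧ Real.pi * (l + 1) / (k + 2) < Real.pi := by
  have hp := Real.pi_pos
  have hl : (l : ℝ) ≤ k := by exact_mod_cast h
  refine ⟨by positivity, ?_⟩
  rw [div_lt_iff₀ (by positivity)]
  nlinarith

theorem chebS_root (k l : ℕ) (h : l ≤ k) :
    aeval (2 * Real.cos (Real.pi * (l + 1) / (k + 2))) (chebS (k + 1)) = 0 := by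
  obtain ⟨h0, h1⟩ := angle_mem k l h
  have hs := Real.sin_pos_of_pos_of_lt_pi h0 h1
  have := (chebS_cos (Real.pi * (l + 1) / (k + 2)) k).2
  have e : ((k : ℝ) + 2) * (Real.pi * (l + 1) / (k + 2)) = ((l + 1 : ℕ) : ℝ) * Real.pi := by
    push_cast; field_simp
  rw [e, Real.sin_nat_mul_pi] at this
  exact (mul_eq_zero.mp this).resolve_right (ne_of_gt hs)

/-- A polynomial `f ∈ ℤ[X]` is divisible by `S_{k+1}` if and only if `f` vanishes at the
special points `2 cos(π(l+1)/(k+2))` for `l = 0, …, k`; i.e. the ideal `I_k(SU(2))` of the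
fusion ring, generated by `χ_{k+1}`, is the ideal of characters vanishing at the special
points `t_l`. -/
theorem statement1 (k : ℕ) (f : Polynomial ℤ) :
    chebS (k + 1) ∣ f ↔
      ∀ l ≤ k, Polynomial.aeval (2 * Real.cos (Real.pi * (l + 1) / (k + 2))) f = 0 := by
  constructor
  · rintro ⟨g, rfl⟩ l hl
    rw [map_mul, chebS_root k l hl, zero_mul]
  · intro hf
    obtain ⟨hm, hd⟩ := (chebS_monic_deg k).2
    rw [← modByMonic_eq_zero_iff_dvd hm]
    have hr : ∀ l ≤ k, aeval (2 * Real.cos (Real.pi * (l + 1) / (k + 2)))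
        (f %ₘ chebS (k + 1)) = 0 := by
      intro l hl
      have := hf l hl
      rw [← modByMonic_add_div f (chebS (k + 1)), map_add, map_mul, chebS_root k l hl,
        zero_mul, add_zero] at this
      exact this
    have hlt : (f %ₘ chebS (k + 1)).natDegree < k + 1 := by
      refine (natDegree_modByMonic_lt f hm ?_).trans_eq hd
      intro h1
      rw [h1] at hd
      simp at hd
    have hinj : Function.Injective (Int.castRingHom ℝ) := Int.cast_injective
    apply Polynomial.map_injective _ hinj
    rw [Polynomial.map_zero]
    refine eq_zero_of_natDegree_lt_card_of_eval_eq_zero _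
      (f := fun i : Fin (k + 1) => 2 * Real.cos (Real.pi * ((i : ℕ) + 1) / (k + 2))) ?_ ?_ ?_
    · intro i j hij
      have hi := angle_mem k i (by omega)
      have hj := angle_mem k j (by omega)
      have h2 := Real.injOn_cos ⟨hi.1.le, hi.2.le⟩ ⟨hj.1.le, hj.2.le⟩
        (mul_left_cancel₀ two_ne_zero hij)
      have hp := Real.pi_ne_zero
      have hk : (k : ℝ) + 2 ≠ 0 := by positivity
      have h3 := mul_left_cancel₀ hp ((div_left_inj' hk).mp h2)
      have h4 : ((i : ℕ) : ℝ) = (j : ℕ) := by linarith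
      exact Fin.ext (by exact_mod_cast h4)
    · intro i
      have := hr i (by omega)
      rw [eval_map]
      exact this
    · rw [natDegree_map_eq_of_injective hinj, Fintype.card_fin]
      exact hlt
end

section
/- Let k be a positive even integer. For every l ∈ {0, 1, ..., k}, ∑_{j=0}^{k/2} (−1)^j sin(π(2j+1)(l+1)/(k+2)) equals (k/2+1)·sin(π(l+1)/(k+2)) if l = k/2, and equals 0 if l ≠ k/2. (This expresses that the element χ = τ_0 − τ_2 + τ_4 − ⋯ + (−1)^{k/2}τ_k of the level k fusion ring satisfies χ(t_{k/2}) = k/2+1 and χ(t_l) = 0 for l ≠ k/2.) -/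
theorem aux_telescope (θ : ℝ) (n : ℕ) :
    (∑ j ∈ Finset.range n, (-1 : ℝ) ^ j * Real.sin ((2 * j + 1) * θ)) * (2 * Real.cos θ) =
      -((-1 : ℝ) ^ n * Real.sin (2 * n * θ)) := by
  induction n with
  | zero => simp
  | succ n ih =>
    rw [Finset.sum_range_succ, add_mul, ih]
    have h1 : Real.sin (2 * ((n + 1 : ℕ) : ℝ) * θ) = Real.sin ((2 * n + 1) * θ + θ) := by
      congr 1; push_cast; ring
    have h2 : Real.sin (2 * (n : ℝ) * θ) = Real.sin ((2 * n + 1) * θ - θ) := by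
      congr 1; ring
    rw [h1, h2, Real.sin_add, Real.sin_sub, pow_succ]
    ring

/-- The element `χ = τ_0 − τ_2 + τ_4 − ⋯ + (−1)^{k/2} τ_k` of the level `k` fusion ring
satisfies `χ(t_{k/2}) = k/2 + 1` and `χ(t_l) = 0` for `l ≠ k/2`: for a positive even
integer `k` and `l ∈ {0,…,k}`,
`∑_{j=0}^{k/2} (−1)^j sin(π(2j+1)(l+1)/(k+2))` equals `(k/2+1)·sin(π(l+1)/(k+2))` if
`l = k/2`, and `0` otherwise. -/
theorem statement3 (k : ℕ) (hk : 0 < k) (hk2 : 2 ∣ k) (l : ℕ) (hl : l ≤ k) :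
    ∑ j ∈ Finset.range (k / 2 + 1),
        (-1 : ℝ) ^ j * Real.sin (Real.pi * (2 * j + 1) * (l + 1) / (k + 2)) =
      if l = k / 2 then ((k / 2 : ℕ) + 1 : ℝ) * Real.sin (Real.pi * (l + 1) / (k + 2))
      else 0 := by
  obtain ⟨m, rfl⟩ := hk2
  have hm : 2 * m / 2 = m := by omega
  rw [hm]
  have hm0 : (0 : ℝ) < (m : ℝ) + 1 := by positivity
  have hsum : ∑ j ∈ Finset.range (m + 1),
        (-1 : ℝ) ^ j * Real.sin (Real.pi * (2 * j + 1) * (l + 1) / ((2 * m : ℕ) + 2)) =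
      ∑ j ∈ Finset.range (m + 1),
        (-1 : ℝ) ^ j * Real.sin ((2 * j + 1) * (Real.pi * (l + 1) / (2 * (m + 1)))) := by
    refine Finset.sum_congr rfl fun j _ => ?_
    congr 2
    push_cast
    field_simp
  rw [hsum]
  split_ifs with h
  · subst h
    have e1 : Real.pi * ((l : ℝ) + 1) / (2 * (l + 1)) = Real.pi / 2 := by
      field_simp
    have e2 : Real.pi * ((l : ℝ) + 1) / ((2 * l : ℕ) + 2) = Real.pi / 2 := by
      push_cast
      field_simp
    rw [e1, e2, Real.sin_pi_div_two]
    have : ∀ j ∈ Finset.range (l + 1),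
        (-1 : ℝ) ^ j * Real.sin ((2 * j + 1) * (Real.pi / 2)) = 1 := by
      intro j _
      have : ((2 * j + 1) * (Real.pi / 2) : ℝ) = Real.pi / 2 + j * Real.pi := by ring
      rw [this, Real.sin_add_nat_mul_pi, Real.sin_pi_div_two, mul_one, ← mul_pow]
      simp
    rw [Finset.sum_congr rfl this]
    simp
  · have key := aux_telescope (Real.pi * (l + 1) / (2 * (m + 1))) (m + 1)
    have e : 2 * ((m + 1 : ℕ) : ℝ) * (Real.pi * (l + 1) / (2 * (m + 1))) =
        ((l + 1 : ℕ) : ℝ) * Real.pi := by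
      push_cast
      field_simp
    rw [e, Real.sin_nat_mul_pi, mul_zero, neg_zero] at key
    refine (mul_eq_zero.mp key).resolve_right fun hc => h ?_
    have hl' : (l : ℝ) ≤ 2 * m := by exact_mod_cast hl
    have hpi := Real.pi_pos
    have hθ : Real.pi * ((l : ℝ) + 1) / (2 * (m + 1)) = Real.pi / 2 := by
      apply Real.injOn_cos
      · constructor
        · positivity
        · rw [div_le_iff₀ (by positivity)]
          nlinarith
      · constructor <;> linarith
      · rw [Real.cos_pi_div_two]; linarith
    field_simp at hθ
    have : (l : ℝ) = m := by linarith
    exact_mod_cast this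
end

section
/- Let k be a positive even integer and set χ̂ = ∑_{j=0}^{k/2} (−1)^j S_{2j} ∈ ℤ[X]. Then (1/2)(S_{k/2}² + χ̂) = ∑_{0 ≤ j ≤ k/2, j even} S_{2j} and (1/2)(S_{k/2}² − χ̂) = ∑_{0 ≤ j ≤ k/2, j odd} S_{2j} in ℤ[X]. In particular, if k is divisible by 4, the two level-k quantizations of the space M = (D_*×D_*)/Γ are Q_+(M) = τ_0 + τ_4 + ⋯ + τ_k and Q_−(M) = τ_2 + τ_6 + ⋯ + τ_{k−2}, while if k ≡ 2 mod 4 they are Q_+(M) = τ_0 + τ_4 + ⋯ + τ_{k−2} and Q_−(M) = τ_2 + τ_6 + ⋯ + τ_k. -/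
open Polynomial

theorem chebS_add (m n : ℕ) :
    chebS (m + n + 2) = chebS (m + 1) * chebS (n + 1) - chebS m * chebS n := by
  induction m using Nat.twoStepInduction with
  | zero => simp [chebS]
  | one =>
    have e : 1 + n + 2 = (n + 1) + 2 := by omega
    rw [e]
    simp only [chebS]
    ring
  | more m h0 h1 =>
    have e : m + 2 + n + 2 = (m + n + 2) + 2 := by omega
    have e1 : m + 1 + n + 2 = m + n + 2 + 1 := by omega
    rw [e, chebS, ← e1, h0, h1]
    simp only [chebS]
    ring

theorem chebS_sum (n : ℕ) :
    ∑ j ∈ Finset.range (n + 1), chebS (2 * j) = chebS n ^ 2 := by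
  induction n with
  | zero => simp [chebS]
  | succ n ih =>
    rw [Finset.sum_range_succ, ih, show 2 * (n + 1) = n + n + 2 by ring, chebS_add]
    ring

/-- For a positive even integer `k`, with `χ̂ = ∑_{j=0}^{k/2} (−1)^j S_{2j} ∈ ℤ[X]`, one has
`(1/2)(S_{k/2}² + χ̂) = ∑_{j even} S_{2j}` and `(1/2)(S_{k/2}² − χ̂) = ∑_{j odd} S_{2j}`
(stated multiplied through by `2`, which is equivalent in `ℤ[X]`).  These are the two
level-`k` quantizations `Q_±(M) = (1/2)((τ_{k/2})² ± χ)` of `M = (D_*×D_*)/Γ`: for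
`4 ∣ k`, `Q_+(M) = τ_0 + τ_4 + ⋯ + τ_k` and `Q_−(M) = τ_2 + τ_6 + ⋯ + τ_{k−2}`, while
for `k ≡ 2 mod 4`, `Q_+(M) = τ_0 + τ_4 + ⋯ + τ_{k−2}` and `Q_−(M) = τ_2 + τ_6 + ⋯ + τ_k`. -/
theorem statement5 (k : ℕ) (hk : 0 < k) (hk2 : 2 ∣ k)
    (chi : Polynomial ℤ)
    (hchi : chi = ∑ j ∈ Finset.range (k / 2 + 1), (-1 : Polynomial ℤ) ^ j * chebS (2 * j)) :
    chebS (k / 2) ^ 2 + chi =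
        2 * ∑ j ∈ (Finset.range (k / 2 + 1)).filter (fun j => Even j), chebS (2 * j) ∧
      chebS (k / 2) ^ 2 - chi =
        2 * ∑ j ∈ (Finset.range (k / 2 + 1)).filter (fun j => Odd j), chebS (2 * j) := by
  subst hchi
  rw [← chebS_sum, ← Finset.sum_add_distrib, ← Finset.sum_sub_distrib, Finset.mul_sum,
    Finset.mul_sum, Finset.sum_filter, Finset.sum_filter]
  constructor
  · refine Finset.sum_congr rfl fun j _ => ?_
    split_ifs with h
    · rw [h.neg_one_pow]; ring
    · rw [(Nat.not_even_iff_odd.mp h).neg_one_pow]; ring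
  · refine Finset.sum_congr rfl fun j _ => ?_
    split_ifs with h
    · rw [h.neg_one_pow]; ring
    · rw [(Nat.not_odd_iff_even.mp h).neg_one_pow]; ring
end
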